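/- Let (Ω, F, ℙ) be a probability space, d ≥ 2 an integer, and let α > 0, c₁ > 0, c₂ > 0, c₃ ≥ 0. Let ψ : [0,∞) × ℝ^d × Ω → ℝ^d be measurable such that for every ω ∈ Ω the map (t,x) ↦ ψ_t(x,ω) is continuous and, in addition, for every ω ∈ Ω and every t ≥ 0 the map x ↦ ψ_t(x,ω) is injective. Assume hypothesis (H): for every r > d there exists c(r) > 0 such that for all x, y ∈ ℝ^d and all T > 0, (𝔼[ sup_{0≤t≤T} |ψ_t(x) − ψ_t(y)|^r ])^{1/r} ≤ c(r)·|x−y|·e^{c₁ r^α T}. Assume further that for each k > 0 and each bounded set S ⊂ ℝ^d one has limsup_{T→∞} (1/T) log sup_{x∈S} ℙ( sup_{0≤t≤T} |ψ_t(x)| ≥ kT ) ≤ −c₂ k² + c₃. Then for every compact set 𝒳 ⊂ ℝ^d, almost surely, limsup_{T→∞} sup_{t∈[0,T]} sup_{x∈𝒳} |ψ_t(x)|/T ≤ κ, where κ = ((c₃ + γ₁(d−1))/c₂)^{1/2} with γ₁ = c₁ d^{α+1} if d < α+1, and κ = ((c₃ + γ₂(d−1))/c₂)^{1/2} with γ₂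 = c₁ ((d−1)/α)^α (1+α)^{1+α} otherwise. -/

import Mathlib

open MeasureTheory Filter Set Metric

section NoRetraction

variable {E : Type*} [NormedAddCommGroup E] [InnerProductSpace ℝ E] [FiniteDimensional ℝ E]

theorem exists_polynomial_det_one_add_smul (A : E →L[ℝ] E) :
    ∃ P : Polynomial ℝ, P.natDegree ≤ Module.finrank ℝ E ∧
      ∀ t : ℝ, (1 + t • A).det = P.eval t := by
  classical
  let b := Module.finBasis ℝ E
  let M := LinearMap.toMatrix b b (A : E →ₗ[ℝ] E)
  refine ⟨Matrix.det ((Polynomial.X : Polynomial ℝ) • M.map Polynomial.C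
    + (1 : Matrix _ _ ℝ).map Polynomial.C), ?_, fun t => ?_⟩
  · simpa using Polynomial.natDegree_det_X_add_C_le M 1
  · rw [← Polynomial.coe_evalRingHom, RingHom.map_det]
    change LinearMap.det ((1 + t • A : E →L[ℝ] E) : E →ₗ[ℝ] E) = _
    rw [← LinearMap.det_toMatrix b]
    congr 1
    ext i j
    simp [M, LinearMap.toMatrix_apply, Matrix.map_apply, Matrix.one_apply, Finsupp.single_apply,
      apply_ite, eq_comm]
    split_ifs <;> ring

theorem exists_lipschitzWith_extend_zero {v : E → E} (hv : ContDiff ℝ 1 v)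
    (h0 : ∀ x, ‖x‖ = 1 → v x = 0) :
    ∃ K, LipschitzWith K ((ball (0 : E) 1).indicator v) := by
  obtain ⟨K, hK⟩ := LocallyLipschitzOn.exists_lipschitzOnWith_of_compact
    (isCompact_closedBall (0 : E) 1) (hv.locallyLipschitz.locallyLipschitzOn)
  refine ⟨K, LipschitzWith.of_dist_le_mul fun x y => ?_⟩
  have key : ∀ x y : E, x ∈ ball (0 : E) 1 → y ∉ ball (0 : E) 1 →
      dist (v x) 0 ≤ K * dist x y := by
    intro x y hx hy
    have hx' : ‖x‖ < 1 := by simpa using hx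
    have hy' : 1 ≤ ‖y‖ := by simpa using hy
    have hb : 1 - ‖x‖ ≤ dist x y := by
      rw [dist_eq_norm, norm_sub_rev]
      linarith [norm_sub_norm_le y x]
    by_cases hx0 : x = 0
    · have hyn : ‖(‖y‖⁻¹ • y)‖ = 1 := by
        rw [norm_smul, norm_inv, norm_norm, inv_mul_cancel₀ (by positivity)]
      have := hK.dist_le_mul x (by simpa using hx'.le) (‖y‖⁻¹ • y) (by simp [hyn])
      rw [h0 _ hyn] at this
      refine this.trans (mul_le_mul_of_nonneg_left ?_ K.2)
      rw [hx0, dist_zero_left, hyn]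
      simpa [hx0] using hb
    · have hxp : 0 < ‖x‖ := norm_pos_iff.2 hx0
      have hyn : ‖(‖x‖⁻¹ • x)‖ = 1 := by
        rw [norm_smul, norm_inv, norm_norm, inv_mul_cancel₀ (by positivity)]
      have := hK.dist_le_mul x (by simpa using hx'.le) (‖x‖⁻¹ • x) (by simp [hyn])
      rw [h0 _ hyn] at this
      refine this.trans (mul_le_mul_of_nonneg_left ?_ K.2)
      refine le_trans (le_of_eq ?_) hb
      have : ‖x‖⁻¹ • x - x = (‖x‖⁻¹ - 1) • x := by rw [sub_smul, one_smul]
      rw [dist_comm, dist_eq_norm, this, norm_smul, Real.norm_of_nonneg, sub_mul,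
        inv_mul_cancel₀ hxp.ne', one_mul]
      have := (one_le_inv₀ hxp).2 hx'.le
      linarith
  by_cases hx : x ∈ ball (0 : E) 1 <;> by_cases hy : y ∈ ball (0 : E) 1
  · rw [indicator_of_mem hx, indicator_of_mem hy]
    exact hK.dist_le_mul _ (ball_subset_closedBall hx) _ (ball_subset_closedBall hy)
  · rw [indicator_of_mem hx, indicator_of_notMem hy]
    exact key x y hx hy
  · rw [indicator_of_notMem hx, indicator_of_mem hy, dist_comm, dist_comm x]
    exact key y x hy hx
  · rw [indicator_of_notMem hx, indicator_of_notMem hy, dist_self]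
    positivity

theorem bijective_add_of_lipschitzWith {u : E → E} {K : NNReal} (hu : LipschitzWith K u)
    (hK : K < 1) : Function.Bijective fun x => x + u x := by
  have happ : ApproximatesLinearOn (fun x => x + u x)
      ((ContinuousLinearEquiv.refl ℝ E : E ≃L[ℝ] E) : E →L[ℝ] E) univ K := by
    intro x _ y _
    have := hu.dist_le_mul x y
    rw [dist_eq_norm, dist_eq_norm] at this
    refine le_trans (le_of_eq (congrArg norm ?_)) this
    change x + u x - (y + u y) - (x - y) = u x - u y
    abel
  have hc : Subsingleton E ∨
      K < ‖((ContinuousLinearEquiv.refl ℝ E).symm : E →L[ℝ] E)‖₊⁻¹ := by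
    cases subsingleton_or_nontrivial E with
    | inl h => exact Or.inl h
    | inr h =>
      right
      have : ‖((ContinuousLinearEquiv.refl ℝ E).symm : E →L[ℝ] E)‖₊ = 1 := by
        ext
        exact ContinuousLinearMap.norm_id
      rw [this]
      simpa using hK
  exact ⟨injOn_univ.1 (happ.injOn hc), happ.surjective hc⟩

theorem image_ball_of_bijective {E : Type*} [NormedAddCommGroup E] {F : E → E}
    (hF : Function.Bijective F)
    (hid : ∀ x ∉ ball (0 : E) 1, F x = x) : F '' ball (0 : E) 1 = ball (0 : E) 1 := by
  ext y
  constructor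
  · rintro ⟨x, hx, rfl⟩
    by_contra h
    exact h (by rwa [hF.1 (hid _ h)])
  · intro hy
    obtain ⟨x, rfl⟩ := hF.2 y
    refine ⟨x, ?_, rfl⟩
    by_contra h
    rw [hid x h] at hy
    exact h hy

theorem not_contDiff_retraction_sphere {R : E → E} (hR : ContDiff ℝ 1 R)
    (hn : ∀ x, ‖R x‖ = 1) (hid : ∀ x, ‖x‖ = 1 → R x = x) : False := by
  let _ : MeasurableSpace E := borel E
  have : BorelSpace E := ⟨rfl⟩
  let v : E → E := fun x => R x - x
  have hv : ContDiff ℝ 1 v := hR.sub contDiff_id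
  obtain ⟨K, hK⟩ := exists_lipschitzWith_extend_zero hv
    (fun x hx => by simp [v, hid x hx])
  have hdv : Continuous (fderiv ℝ v) := hv.continuous_fderiv one_ne_zero
  let D : ℝ → E → ℝ := fun t x => (1 + t • fderiv ℝ v x).det
  have hD : Continuous fun p : ℝ × E => D p.1 p.2 := by
    apply ContinuousLinearMap.continuous_det.comp
    fun_prop
  have hpos : ∀ᶠ t in nhds (0 : ℝ), ∀ x ∈ closedBall (0 : E) 1, 0 < D t x := by
    apply (isCompact_closedBall (0 : E) 1).eventually_forall_of_forall_eventually
    intro x _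
    have h1 : 0 < D (0, x).1 (0, x).2 := by
      simp [D, ContinuousLinearMap.det]
    exact (hD.tendsto (0, x)).eventually (lt_mem_nhds h1)
  have hsmall : ∀ᶠ t in nhds (0 : ℝ), ‖t‖₊ * K < 1 := by
    have : Continuous fun t : ℝ => ‖t‖₊ * K := by fun_prop
    exact (this.tendsto 0).eventually (gt_mem_nhds (by simp))
  obtain ⟨ε, hε, hall⟩ := Metric.eventually_nhds_iff.1 (hpos.and hsmall)
  have hvol : ∀ t : ℝ, |t| < ε → ∫ x in ball (0 : E) 1, D t x = volume.real (ball (0 : E) 1) := by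
    intro t ht
    obtain ⟨hp, hs⟩ := hall (by simpa using ht)
    let F : E → E := fun x => x + t • (ball (0 : E) 1).indicator v x
    have hF : Function.Bijective F := by
      refine bijective_add_of_lipschitzWith (u := fun x => t • (ball (0 : E) 1).indicator v x)
        ?_ hs
      exact (lipschitzWith_smul t).comp hK
    have himg := image_ball_of_bijective hF
      (fun x hx => by simp only [F, indicator_of_notMem hx, smul_zero, add_zero])
    have hder : ∀ x ∈ ball (0 : E) 1,
        HasFDerivWithinAt F (1 + t • fderiv ℝ v x) (ball (0 : E) 1) x := by
      intro x hx
      have h1 : HasFDerivAt (fun x => x + t • v x) (1 + t • fderiv ℝ v x) x :=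
        (hasFDerivAt_id x).add
          (((hv.differentiable one_ne_zero) x).hasFDerivAt.const_smul t)
      refine h1.hasFDerivWithinAt.congr (fun y hy => ?_) ?_
      · simp only [F, indicator_of_mem hy]
      · simp only [F, indicator_of_mem hx]
    have := integral_image_eq_integral_abs_det_fderiv_smul volume measurableSet_ball hder
      hF.1.injOn (fun _ => (1 : ℝ))
    rw [himg] at this
    simp only [smul_eq_mul, mul_one, integral_const, measureReal_restrict_apply_univ] at this
    rw [this]
    refine setIntegral_congr_fun measurableSet_ball fun x hx => ?_
    exact (abs_of_pos (hp x (ball_subset_closedBall hx))).symm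
  have hint : ∀ t : ℝ, IntegrableOn (D t) (ball (0 : E) 1) := fun t => by
    have hDt : Continuous (D t) := hD.comp (by fun_prop : Continuous fun x : E => (t, x))
    exact (hDt.continuousOn.integrableOn_compact (isCompact_closedBall _ _)).mono_set
      ball_subset_closedBall
  let n := Module.finrank ℝ E
  let s : Finset ℕ := Finset.range (n + 1)
  let τ : ℕ → ℝ := fun i => ε / (i + 2)
  have hτ : InjOn τ s := by
    intro i _ j _ hij
    simp only [τ] at hij
    have hi : (0 : ℝ) < (i : ℝ) + 2 := by positivity
    have hj : (0 : ℝ) < (j : ℝ) + 2 := by positivity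
    rw [div_eq_div_iff hi.ne' hj.ne'] at hij
    have := mul_left_cancel₀ hε.ne' hij
    exact_mod_cast (add_right_cancel this).symm
  have hτε : ∀ i, |τ i| < ε := fun i => by
    have : (0 : ℝ) ≤ i := i.cast_nonneg
    rw [abs_of_nonneg (by positivity), div_lt_iff₀ (by positivity)]
    nlinarith
  let w : ℕ → ℝ := fun i => (Lagrange.basis s τ i).eval 1
  have hw : ∀ P : Polynomial ℝ, P.natDegree ≤ n → P.eval 1 = ∑ i ∈ s, P.eval (τ i) * w i := by
    intro P hP
    have hd : P.degree < s.card := by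
      rw [Finset.card_range]
      exact (Polynomial.degree_le_of_natDegree_le hP).trans_lt (by exact_mod_cast n.lt_succ_self)
    conv_lhs => rw [Lagrange.eq_interpolate hτ hd]
    simp [Lagrange.interpolate_apply, Polynomial.eval_finsetSum, w]
  have hw1 : ∑ i ∈ s, w i = 1 := by
    have := hw 1 (by simp)
    simpa using this.symm
  have hD1 : ∀ x, D 1 x = ∑ i ∈ s, D (τ i) x * w i := by
    intro x
    obtain ⟨P, hP, hPe⟩ := exists_polynomial_det_one_add_smul (fderiv ℝ v x)
    simp only [D, hPe]
    exact hw P hP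
  have hI1 : ∫ x in ball (0 : E) 1, D 1 x = volume.real (ball (0 : E) 1) := by
    simp only [hD1]
    rw [integral_finsetSum _ fun i _ => (hint (τ i)).mul_const _]
    simp only [integral_mul_const, hvol _ (hτε _)]
    rw [← Finset.mul_sum, hw1, mul_one]
  have hzero : ∀ x, D 1 x = 0 := by
    intro x
    have h1 : (1 : E →L[ℝ] E) + (1 : ℝ) • fderiv ℝ v x = fderiv ℝ R x := by
      have : fderiv ℝ v x = fderiv ℝ R x - 1 := by
        exact (((hR.differentiable one_ne_zero) x).hasFDerivAt.sub (hasFDerivAt_id x)).fderiv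
      rw [this]
      simp
    simp only [D, h1]
    have horth : ∀ z, inner ℝ (R x) (fderiv ℝ R x z) = 0 := by
      intro z
      have hdR := ((hR.differentiable one_ne_zero) x).hasFDerivAt
      have h2 := hdR.inner ℝ hdR
      have h3 : (fun y => inner ℝ (R y) (R y)) = fun _ => (1 : ℝ) := by
        funext y
        rw [real_inner_self_eq_norm_sq, hn, one_pow]
      rw [h3] at h2
      have h4 := congrArg (fun L : E →L[ℝ] ℝ => L z) (h2.unique (hasFDerivAt_const (1 : ℝ) x))
      simp [fderivInnerCLM_apply, real_inner_comm] at h4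
      linarith
    by_contra hne
    have hsurj : Function.Surjective (fderiv ℝ R x) := by
      have : IsUnit (LinearMap.det (fderiv ℝ R x : E →ₗ[ℝ] E)) := isUnit_iff_ne_zero.2 hne
      exact (LinearEquiv.ofIsUnitDet (v := Module.finBasis ℝ E) (v' := Module.finBasis ℝ E)
        (f := (fderiv ℝ R x : E →ₗ[ℝ] E)) (by
          rw [LinearMap.det_toMatrix]; exact this)).surjective
    obtain ⟨z, hz⟩ := hsurj (R x)
    have := horth z
    rw [hz, real_inner_self_eq_norm_sq, hn] at this
    norm_num at this
  simp only [hzero, integral_zero] at hI1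
  have : 0 < volume.real (ball (0 : E) 1) :=
    ENNReal.toReal_pos (measure_ball_pos _ _ one_pos).ne' measure_ball_lt_top.ne
  linarith

theorem exists_zero_of_norm_sub_le {h : E → E} (hc : Continuous h)
    (hh : ∀ x ∈ closedBall (0 : E) 1, ‖h x - x‖ ≤ 1 / 4) :
    ∃ x ∈ closedBall (0 : E) 1, h x = 0 := by
  by_contra! hne
  obtain ⟨x₀, hx₀, hmin⟩ := (isCompact_closedBall (0 : E) 1).exists_isMinOn
    ⟨0, by simp⟩ hc.norm.continuousOn
  have hm : 0 < ‖h x₀‖ := norm_pos_iff.2 (hne x₀ hx₀)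
  obtain ⟨g, hg, hgd, -⟩ := hc.exists_contDiff_approx 1
    (ε := fun _ => min ‖h x₀‖ (1 / 8)) continuous_const (fun _ => lt_min hm (by norm_num))
  have hg1 : ∀ x ∈ closedBall (0 : E) 1, g x ≠ 0 := by
    intro x hx h0
    have h1 := (hgd x).trans_le (min_le_left _ _)
    rw [h0, dist_zero_left] at h1
    exact absurd (hmin hx) (not_le.2 h1)
  have hg2 : ∀ x ∈ closedBall (0 : E) 1, ‖g x - x‖ ≤ 3 / 8 := by
    intro x hx
    have h1 := (hgd x).trans_le (min_le_right _ _)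
    rw [dist_eq_norm] at h1
    have h2 := norm_add_le (g x - h x) (h x - x)
    rw [sub_add_sub_cancel] at h2
    linarith [hh x hx]
  let χ : ContDiffBump (0 : E) := ⟨1 / 2, 1, by norm_num, by norm_num⟩
  let F : E → E := fun x => x + χ x • (g x - x)
  have hF : ContDiff ℝ 1 F := contDiff_id.add (χ.contDiff.smul (hg.sub contDiff_id))
  have hFid : ∀ x, 1 ≤ ‖x‖ → F x = x := by
    intro x hx
    simp only [F]
    rw [χ.zero_of_le_dist (by simpa using hx), zero_smul, add_zero]
  have hF0 : ∀ x, F x ≠ 0 := by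
    intro x
    rcases le_total 1 ‖x‖ with hx | hx
    · rw [hFid x hx, ← norm_pos_iff]
      linarith
    · have hxb : x ∈ closedBall (0 : E) 1 := by simpa using hx
      rcases le_total ‖x‖ (1 / 2) with hx2 | hx2
      · have : F x = g x := by
          simp only [F]
          rw [χ.one_of_mem_closedBall (mem_closedBall_zero_iff.2 hx2), one_smul, add_sub_cancel]
        rw [this]
        exact hg1 x hxb
      · intro h0
        have h1 : ‖x‖ = ‖χ x • (g x - x)‖ := by
          rw [← norm_neg (χ x • (g x - x)), ← eq_neg_of_add_eq_zero_left h0]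
        rw [norm_smul, Real.norm_of_nonneg χ.nonneg] at h1
        have h2 : χ x * ‖g x - x‖ ≤ 1 * (3 / 8) :=
          mul_le_mul χ.le_one (hg2 x hxb) (norm_nonneg _) zero_le_one
        linarith
  refine not_contDiff_retraction_sphere (R := fun x => ‖F x‖⁻¹ • F x)
    (((hF.norm ℝ hF0).inv fun x => norm_ne_zero_iff.2 (hF0 x)).smul hF) (fun x => ?_)
    (fun x hx => ?_)
  · rw [norm_smul, norm_inv, norm_norm, inv_mul_cancel₀ (norm_ne_zero_iff.2 (hF0 x))]
  · simp only [hFid x hx.ge, hx, inv_one, one_smul]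

end NoRetraction

section MaximumPrinciple

variable {E : Type*} [NormedAddCommGroup E] [InnerProductSpace ℝ E] [FiniteDimensional ℝ E]

theorem exists_continuous_leftInverse_of_injOn {f : E → E} (hf : Continuous f) {s : Set E}
    (hs : IsCompact s) (hinj : InjOn f s) :
    ∃ g : E → E, Continuous g ∧ ∀ x ∈ s, g (f x) = x := by
  have : CompactSpace s := isCompact_iff_compactSpace.1 hs
  have he : Topology.IsClosedEmbedding fun x : s => f x :=
    (hf.comp continuous_subtype_val).isClosedEmbedding hinj.injective
  let b := (stdOrthonormalBasis ℝ E).toBasis.equivFunL.toHomeomorph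
  obtain ⟨g, hg⟩ := ContinuousMap.exists_extension' he
    (⟨fun x : s => b x, by fun_prop⟩ : C(s, Fin (Module.finrank ℝ E) → ℝ))
  refine ⟨fun y => b.symm (g y), by fun_prop, fun x hx => ?_⟩
  have := congrFun hg ⟨x, hx⟩
  simp only [Function.comp_apply] at this
  exact (congrArg b.symm this).trans (b.symm_apply_apply x)

theorem exists_norm_lt_of_injective_unitBall [Nontrivial E] {f : E → E} (hf : Continuous f)
    (hinj : Function.Injective f) : ∃ x ∈ closedBall (0 : E) 1, ‖f 0‖ < ‖f x‖ := by
  let _ : MeasurableSpace E := borel E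
  have : BorelSpace E := ⟨rfl⟩
  by_contra! hmax
  set M := ‖f 0‖ with hM
  have hB := isCompact_closedBall (0 : E) 1
  have hMpos : 0 < M := by
    obtain ⟨y, hy⟩ := exists_norm_eq E (zero_le_one (α := ℝ))
    by_contra hM0
    have h1 : f y = 0 := norm_le_zero_iff.1 ((hmax y (by simp [hy])).trans (not_lt.1 hM0))
    have h2 : f 0 = 0 := norm_le_zero_iff.1 (not_lt.1 hM0)
    have := hinj (h1.trans h2.symm)
    rw [this, norm_zero] at hy
    exact zero_ne_one hy
  obtain ⟨G, hG, hGf⟩ := exists_continuous_leftInverse_of_injOn hf hB hinj.injOn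
  obtain ⟨ε, hε, hGε⟩ := Metric.uniformContinuousOn_iff_le.1
    ((isCompact_closedBall (0 : E) M).uniformContinuousOn_of_continuous hG.continuousOn)
    (1 / 8) (by norm_num)
  set ρ := M - min ε (M / 2) with hρ
  have hρ0 : 0 < ρ := by linarith [min_le_right ε (M / 2)]
  have hρM : ρ < M := by linarith [lt_min hε (half_pos hMpos)]
  have hρε : M - ρ ≤ ε := by linarith [min_le_left ε (M / 2)]
  let π : E → E := fun y => (ρ / max ρ ‖y‖) • y
  have hmaxpos : ∀ y : E, 0 < max ρ ‖y‖ := fun y => lt_max_of_lt_left hρ0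
  have hπ : Continuous π :=
    (continuous_const.div (by fun_prop) fun y => (hmaxpos y).ne').smul continuous_id
  have hπin : ∀ y, ‖y‖ ≤ ρ → π y = y := by
    intro y hy
    simp only [π, max_eq_left hy, div_self hρ0.ne', one_smul]
  have hπout : ∀ y, ρ ≤ ‖y‖ → ‖π y‖ = ρ := by
    intro y hy
    have : 0 < ‖y‖ := hρ0.trans_le hy
    simp only [π, max_eq_right hy, norm_smul, norm_div, norm_norm, Real.norm_of_nonneg hρ0.le]
    field_simp
  have hπnorm : ∀ y, ‖π y‖ ≤ ρ := by
    intro y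
    rcases le_total ‖y‖ ρ with h | h
    · rwa [hπin y h]
    · exact (hπout y h).le
  have hπdist : ∀ y, ‖y‖ ≤ M → dist (π y) y ≤ ε := by
    intro y hy
    rcases le_total ‖y‖ ρ with h | h
    · rw [hπin y h, dist_self]
      exact hε.le
    · have hy0 : 0 < ‖y‖ := hρ0.trans_le h
      have h1 : y - π y = (1 - ρ / ‖y‖) • y := by
        simp only [π, max_eq_right h, sub_smul, one_smul]
      have h2 : 0 ≤ 1 - ρ / ‖y‖ := sub_nonneg.2 ((div_le_one hy0).2 h)
      rw [dist_comm, dist_eq_norm, h1, norm_smul, Real.norm_of_nonneg h2, sub_mul,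
        div_mul_cancel₀ _ hy0.ne', one_mul]
      linarith
  have hK1 : IsCompact (f '' closedBall 0 1 ∩ closedBall 0 ρ) :=
    (hB.image hf).inter_right isClosed_closedBall
  have hGne : ∀ y ∈ f '' closedBall 0 1 ∩ closedBall 0 ρ, G y ≠ 0 := by
    rintro _ ⟨⟨x, hx, rfl⟩, hy⟩ h0
    rw [hGf x hx] at h0
    rw [h0, mem_closedBall_zero_iff] at hy
    linarith
  obtain ⟨m, hm, hGm⟩ : ∃ m > 0, ∀ y ∈ f '' closedBall 0 1 ∩ closedBall 0 ρ, m ≤ ‖G y‖ := by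
    rcases (f '' closedBall 0 1 ∩ closedBall 0 ρ).eq_empty_or_nonempty with h | h
    · exact ⟨1, one_pos, by simp [h]⟩
    · obtain ⟨y, hy, hmin⟩ := hK1.exists_isMinOn h hG.norm.continuousOn
      exact ⟨‖G y‖, norm_pos_iff.2 (hGne y hy), fun z hz => hmin hz⟩
  set η := min (m / 2) (1 / 16) with hη
  have hη0 : 0 < η := lt_min (half_pos hm) (by norm_num)
  obtain ⟨P, hP, hPd, -⟩ := hG.exists_contDiff_approx 1 (ε := fun _ => η) continuous_const
    (fun _ => hη0)
  obtain ⟨σ, hσn, hσ⟩ : ∃ σ ∈ ball (0 : E) η, σ ∉ P '' sphere 0 ρ := by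
    by_contra! hall
    have h0 : volume (P '' sphere 0 ρ) = 0 :=
      addHaar_image_eq_zero_of_differentiableOn_of_addHaar_eq_zero volume
        (hP.differentiable one_ne_zero).differentiableOn
        (Measure.addHaar_sphere_of_ne_zero volume 0 hρ0.ne')
    exact (measure_ball_pos volume (0 : E) hη0).ne' (measure_mono_null hall h0)
  rw [mem_ball_zero_iff] at hσn
  have hclose : ∀ y, ‖P y - σ - G y‖ < η + η := by
    intro y
    have h1 := hPd y
    rw [dist_eq_norm] at h1
    calc ‖P y - σ - G y‖ = ‖(P y - G y) - σ‖ := by congr 1; abel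
      _ ≤ ‖P y - G y‖ + ‖σ‖ := norm_sub_le _ _
      _ < η + η := add_lt_add h1 hσn
  obtain ⟨x, hx, hx0⟩ := exists_zero_of_norm_sub_le (h := fun x => P (π (f x)) - σ)
    ((hP.continuous.comp (hπ.comp hf)).sub continuous_const) (by
      intro x hx
      have h1 := hclose (π (f x))
      have h2 := hGε (π (f x)) (by simpa using (hπnorm _).trans hρM.le) (f x)
        (by simpa using hmax x hx) (hπdist _ (hmax x hx))
      rw [hGf x hx, dist_eq_norm] at h2
      have h3 := norm_add_le (P (π (f x)) - σ - G (π (f x))) (G (π (f x)) - x)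
      rw [sub_add_sub_cancel] at h3
      linarith [min_le_right (m / 2) (1 / 16)])
  rcases le_total ‖f x‖ ρ with h | h
  · rw [hπin _ h] at hx0
    have h1 := hclose (f x)
    rw [hx0, zero_sub, norm_neg] at h1
    have h2 := hGm (f x) ⟨⟨x, hx, rfl⟩, by simpa using h⟩
    linarith [min_le_left (m / 2) (1 / 16)]
  · exact hσ ⟨π (f x), by simpa using hπout _ h, sub_eq_zero.1 hx0⟩

theorem exists_norm_lt_of_injective [Nontrivial E] {f : E → E} (hf : Continuous f)
    (hinj : Function.Injective f) (x₀ : E) {r : ℝ} (hr : 0 < r) :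
    ∃ x ∈ closedBall x₀ r, ‖f x₀‖ < ‖f x‖ := by
  obtain ⟨x, hx, hlt⟩ := exists_norm_lt_of_injective_unitBall
    (f := fun x => f (x₀ + r • x)) (by fun_prop) (fun x y hxy => by
      have := add_left_cancel (hinj hxy)
      exact smul_right_injective E hr.ne' this)
  refine ⟨x₀ + r • x, ?_, by simpa using hlt⟩
  rw [mem_closedBall_zero_iff] at hx
  rw [mem_closedBall, dist_eq_norm, add_sub_cancel_left, norm_smul, Real.norm_of_nonneg hr.le]
  nlinarith

/-- An injective continuous self-map of a Euclidean space attains its largest norm over a compact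
set on the frontier of that set. -/
theorem exists_frontier_norm_le_of_injective [Nontrivial E] {f : E → E} (hf : Continuous f)
    (hinj : Function.Injective f) {s : Set E} (hs : IsCompact s) {x : E} (hx : x ∈ s) :
    ∃ y ∈ frontier s, ‖f x‖ ≤ ‖f y‖ := by
  obtain ⟨y, hy, hmax⟩ := hs.exists_isMaxOn ⟨x, hx⟩ hf.norm.continuousOn
  refine ⟨y, ⟨subset_closure hy, fun hyi => ?_⟩, hmax hx⟩
  obtain ⟨r, hr, hrs⟩ := Metric.nhds_basis_closedBall.mem_iff.1 (mem_interior_iff_mem_nhds.1 hyi)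
  obtain ⟨z, hz, hlt⟩ := exists_norm_lt_of_injective hf hinj y hr
  exact absurd (hmax (hrs hz)) (not_le.2 hlt)

end MaximumPrinciple

section RealSup

theorem le_biSup_of_image_bddAbove {ι : Type*} {s : Set ι} {g : ι → ℝ} (hb : BddAbove (g '' s))
    {i : ι} (hi : i ∈ s) : g i ≤ ⨆ j ∈ s, g j := by
  obtain ⟨b, hb⟩ := hb
  have hbdd : BddAbove (range fun j => ⨆ _ : j ∈ s, g j) := by
    refine ⟨max b 0, ?_⟩
    rintro _ ⟨j, rfl⟩
    exact Real.iSup_le (fun hj => (hb ⟨j, hj, rfl⟩).trans (le_max_left _ _)) (le_max_right _ _)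
  refine le_trans (le_of_eq ?_) (le_ciSup hbdd i)
  simp [hi]

theorem biSup_le_of_forall_le {ι : Type*} {s : Set ι} {g : ι → ℝ} {a : ℝ}
    (h : ∀ i ∈ s, g i ≤ a) (ha : 0 ≤ a) : ⨆ j ∈ s, g j ≤ a :=
  Real.iSup_le (fun i => Real.iSup_le (h i) ha) ha

theorem Continuous.le_biSup_Icc {g : ℝ → ℝ} (hg : Continuous g) {t T : ℝ} (ht : t ∈ Icc 0 T) :
    g t ≤ ⨆ s ∈ Icc (0 : ℝ) T, g s :=
  le_biSup_of_image_bddAbove (isCompact_Icc.image hg).bddAbove ht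

theorem biSup_Icc_nonneg {g : ℝ → ℝ} (hg : ∀ t, 0 ≤ g t) (T : ℝ) :
    0 ≤ ⨆ s ∈ Icc (0 : ℝ) T, g s :=
  Real.iSup_nonneg fun t => Real.iSup_nonneg fun _ => hg t

theorem biSup_Icc_eq_iSup_rat {g : ℝ → ℝ} (hg : Continuous g) (h0 : ∀ t, 0 ≤ g t) {T : ℝ}
    (hT : 0 ≤ T) : ⨆ s ∈ Icc (0 : ℝ) T, g s = ⨆ q : ℚ, g (max 0 (min T q)) := by
  have hmem : ∀ s : ℝ, max 0 (min T s) ∈ Icc 0 T := fun s =>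
    ⟨le_max_left _ _, max_le hT (min_le_left _ _)⟩
  have hbdd : BddAbove (range fun q : ℚ => g (max 0 (min T q))) := by
    refine ⟨⨆ s ∈ Icc (0 : ℝ) T, g s, ?_⟩
    rintro _ ⟨q, rfl⟩
    exact hg.le_biSup_Icc (hmem q)
  refine le_antisymm (biSup_le_of_forall_le (fun t ht => ?_) (Real.iSup_nonneg fun q => h0 _))
    (Real.iSup_le (fun q => hg.le_biSup_Icc (hmem q)) (biSup_Icc_nonneg h0 T))
  have hcl : IsClosed {s : ℝ | g (max 0 (min T s)) ≤ ⨆ q : ℚ, g (max 0 (min T q))} :=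
    isClosed_le (by fun_prop) continuous_const
  have := isClosed_property Rat.isDenseEmbedding_coe_real.dense hcl (fun q => le_ciSup hbdd q) t
  rwa [min_eq_right ht.2, max_eq_right ht.1] at this

theorem measurable_biSup_Icc {Ω : Type*} [MeasurableSpace Ω] {g : ℝ → Ω → ℝ}
    (hm : ∀ t, Measurable (g t)) (hg : ∀ ω, Continuous fun t => g t ω) (h0 : ∀ t ω, 0 ≤ g t ω)
    {T : ℝ} (hT : 0 ≤ T) : Measurable fun ω => ⨆ s ∈ Icc (0 : ℝ) T, g s ω := by
  simp_rw [fun ω => biSup_Icc_eq_iSup_rat (hg ω) (fun t => h0 t ω) hT]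
  exact Measurable.iSup fun q => hm _

end RealSup

section Tails

variable {Ω : Type*} [MeasurableSpace Ω] {μ : Measure Ω}

theorem integrable_rpow_of_exp_tail [IsProbabilityMeasure μ] {Z : Ω → ℝ} (hZ : Measurable Z)
    (h0 : ∀ ω, 0 ≤ Z ω) {k T₀ : ℝ} (hk : 0 < k) (hT₀ : 0 ≤ T₀)
    (htail : ∀ T ≥ T₀, μ {ω | k * T ≤ Z ω} ≤ ENNReal.ofReal (Real.exp (-T)))
    {r : ℝ} (hr : 0 < r) : Integrable (fun ω => Z ω ^ r) μ := by
  refine ⟨(hZ.pow_const r).aestronglyMeasurable, ?_⟩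
  rw [hasFiniteIntegral_iff_ofReal (Eventually.of_forall fun ω => Real.rpow_nonneg (h0 ω) r),
    lintegral_rpow_eq_lintegral_meas_le_mul μ (Eventually.of_forall h0) hZ.aemeasurable hr]
  refine ENNReal.mul_lt_top ENNReal.ofReal_lt_top ?_
  have htail' : ∀ u > 0, μ {ω | u ≤ Z ω} ≤ ENNReal.ofReal (Real.exp T₀ * Real.exp (-k⁻¹ * u)) := by
    intro u hu
    rw [← Real.exp_add]
    rcases le_total T₀ (k⁻¹ * u) with h | h
    · have := htail _ h
      rw [mul_inv_cancel_left₀ hk.ne'] at this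
      refine this.trans (ENNReal.ofReal_le_ofReal (Real.exp_le_exp.2 ?_))
      linarith
    · refine prob_le_one.trans ?_
      rw [← ENNReal.ofReal_one]
      exact ENNReal.ofReal_le_ofReal (Real.one_le_exp (by linarith))
  have hint : IntegrableOn
      (fun u : ℝ => Real.exp T₀ * (u ^ (r - 1) * Real.exp (-k⁻¹ * u))) (Ioi 0) := by
    have := integrableOn_rpow_mul_exp_neg_mul_rpow (p := 1) (s := r - 1) (b := k⁻¹)
      (by linarith) one_pos (inv_pos.2 hk)
    simp only [Real.rpow_one] at this
    exact this.const_mul _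
  refine lt_of_le_of_lt (setLIntegral_mono_ae' measurableSet_Ioi
    (Eventually.of_forall fun u hu => ?_)) hint.lintegral_lt_top
  refine (mul_le_mul_left (htail' u hu) _).trans ?_
  rw [← ENNReal.ofReal_mul (by positivity)]
  exact ENNReal.ofReal_le_ofReal (le_of_eq (by ring))

theorem measure_ge_le_of_integral_rpow_le [IsFiniteMeasure μ] {Z : Ω → ℝ} (h0 : ∀ ω, 0 ≤ Z ω)
    {r : ℝ} (hr : 0 < r) (hint : Integrable (fun ω => Z ω ^ r) μ) {b : ℝ}
    (hb : (∫ ω, Z ω ^ r ∂μ) ^ (1 / r) ≤ b) {a : ℝ} (ha : 0 < a) :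
    μ {ω | a ≤ Z ω} ≤ ENNReal.ofReal ((b / a) ^ r) := by
  have hI0 : 0 ≤ ∫ ω, Z ω ^ r ∂μ := integral_nonneg fun ω => Real.rpow_nonneg (h0 ω) r
  have hb0 : 0 ≤ b := (Real.rpow_nonneg hI0 _).trans hb
  have hI : ∫ ω, Z ω ^ r ∂μ ≤ b ^ r := by
    have := Real.rpow_le_rpow (Real.rpow_nonneg hI0 _) hb hr.le
    rwa [← Real.rpow_mul hI0, one_div, inv_mul_cancel₀ hr.ne', Real.rpow_one] at this
  have hM := mul_meas_ge_le_integral_of_nonneg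
    (Eventually.of_forall fun ω => Real.rpow_nonneg (h0 ω) r) hint (a ^ r)
  have hset : {ω | a ^ r ≤ Z ω ^ r} = {ω | a ≤ Z ω} := by
    ext ω
    exact Real.rpow_le_rpow_iff ha.le (h0 ω) hr
  rw [hset] at hM
  rw [← ENNReal.ofReal_toReal (measure_ne_top μ {ω | a ≤ Z ω}), Real.div_rpow hb0 ha.le]
  refine ENNReal.ofReal_le_ofReal ?_
  rw [le_div_iff₀ (Real.rpow_pos_of_pos ha r), mul_comm]
  exact hM.trans hI

theorem ae_eventually_notMem_of_le_exp {s : ℕ → Set Ω} {C δ : ℝ} (hδ : 0 < δ)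
    (h : ∀ᶠ n in atTop, μ (s n) ≤ ENNReal.ofReal (C * Real.exp (-δ * n))) :
    ∀ᵐ ω ∂μ, ∀ᶠ n in atTop, ω ∉ s n := by
  obtain ⟨n₀, hn₀⟩ := eventually_atTop.1 h
  have hsum : Summable fun n : ℕ => |C| * Real.exp (-δ * n) := by
    refine Summable.mul_left _ ?_
    have := Real.summable_exp_nat_mul_of_ge (c := -δ) (by linarith) (f := fun n => (n : ℝ))
      (fun _ => le_rfl)
    simpa using this
  have hfin : ∑' n, μ (s (n + n₀)) ≠ ⊤ := by
    refine ne_top_of_le_ne_top ((summable_nat_add_iff n₀).2 hsum).tsum_ofReal_ne_top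
      (ENNReal.tsum_le_tsum fun n => ?_)
    refine (hn₀ _ (Nat.le_add_left _ _)).trans (ENNReal.ofReal_le_ofReal ?_)
    exact mul_le_mul_of_nonneg_right (le_abs_self C) (Real.exp_pos _).le
  filter_upwards [ae_eventually_notMem hfin] with ω hω
  obtain ⟨m, hm⟩ := eventually_atTop.1 hω
  refine eventually_atTop.2 ⟨m + n₀, fun n hn => ?_⟩
  have := hm (n - n₀) (by omega)
  rwa [Nat.sub_add_cancel (by omega)] at this

theorem eventually_le_exp_of_limsup_log_lt {A : ℝ → ENNReal} {a b : ℝ}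
    (h : limsup (fun T : ℝ => ((1 / T : ℝ) : EReal) * ENNReal.log (A T)) atTop ≤ (a : EReal))
    (hab : a < b) : ∀ᶠ T in atTop, A T ≤ ENNReal.ofReal (Real.exp (b * T)) := by
  have hlt := eventually_lt_of_limsup_lt (h.trans_lt (EReal.coe_lt_coe_iff.2 hab))
  filter_upwards [hlt, eventually_gt_atTop 0] with T hT hT0
  have h1 : ((T : ℝ) : EReal) * (((1 / T : ℝ) : EReal) * ENNReal.log (A T))
      ≤ ((T : ℝ) : EReal) * (b : EReal) :=
    mul_le_mul_of_nonneg_left hT.le (EReal.coe_nonneg.2 hT0.le)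
  rw [← mul_assoc, ← EReal.coe_mul, mul_one_div_cancel hT0.ne', EReal.coe_one, one_mul,
    ← EReal.coe_mul] at h1
  have h2 := EReal.exp_monotone h1
  rwa [ENNReal.exp_log, EReal.exp_coe, mul_comm] at h2

end Tails

section Limsup

theorem limsup_biSup_div_le {E : Type*} [NormedAddCommGroup E] {f : ℝ → E → E} {s : Set E}
    {k C : ℝ} (hk : 0 ≤ k) (hC : 0 ≤ C)
    (h : ∀ᶠ n : ℕ in atTop, ∀ t ∈ Icc (0 : ℝ) n, ∀ x ∈ s, ‖f t x‖ ≤ k * n + C) :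
    limsup (fun T : ℝ => (((1 / T) * ⨆ t ∈ Icc (0 : ℝ) T, ⨆ x ∈ s, ‖f t x‖ : ℝ) : EReal)) atTop
      ≤ (k : EReal) := by
  have hlim : Tendsto (fun T : ℝ => ((k + (k + C) * T⁻¹ : ℝ) : EReal)) atTop
      (nhds (k : EReal)) := by
    refine (continuous_coe_real_ereal.tendsto k).comp ?_
    simpa using (tendsto_const_nhds (x := k)).add
      ((tendsto_inv_atTop_zero (𝕜 := ℝ)).const_mul (k + C))
  rw [← hlim.limsup_eq]
  refine limsup_le_limsup ?_
  filter_upwards [(tendsto_nat_ceil_atTop (α := ℝ)).eventually h, eventually_gt_atTop 0]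
    with T hT hT0
  refine EReal.coe_le_coe_iff.2 ?_
  have hn : (⌈T⌉₊ : ℝ) < T + 1 := Nat.ceil_lt_add_one hT0.le
  have hsup : ⨆ t ∈ Icc (0 : ℝ) T, ⨆ x ∈ s, ‖f t x‖ ≤ k * (T + 1) + C := by
    have hb : 0 ≤ k * (T + 1) + C := by positivity
    refine biSup_le_of_forall_le (fun t ht => biSup_le_of_forall_le (fun x hx => ?_) hb) hb
    refine (hT t ⟨ht.1, ht.2.trans (Nat.le_ceil T)⟩ x hx).trans ?_
    nlinarith
  rw [one_div]
  calc T⁻¹ * _ ≤ T⁻¹ * (k * (T + 1) + C) := by gcongr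
    _ = k + (k + C) * T⁻¹ := by field_simp; ring

end Limsup

section Grid

variable {d : ℕ}

/-- The point of the dyadic grid of mesh `2⁻ᵐ` with integer coordinates `z`. -/
noncomputable def dyadicPoint (m : ℕ) (z : Fin d → ℤ) : EuclideanSpace ℝ (Fin d) :=
  WithLp.toLp 2 fun i => (z i : ℝ) / 2 ^ m

/-- The indices of the dyadic grid points of mesh `2⁻ᵐ` lying on the boundary of `[-N, N]ᵈ`. -/
noncomputable def boundaryGrid (d N m : ℕ) : Finset (Fin d → ℤ) :=
  {z ∈ Fintype.piFinset fun _ => Finset.Icc (-(N * 2 ^ m : ℤ)) (N * 2 ^ m) |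
    ∃ i, |z i| = N * 2 ^ m}

/-- The cube `[-N, N]ᵈ`. -/
def cube (d N : ℕ) : Set (EuclideanSpace ℝ (Fin d)) := {x | ∀ i, |x i| ≤ N}

theorem card_boundaryGrid_le {d N : ℕ} (hN : 1 ≤ N) (m : ℕ) :
    ((boundaryGrid d N m).card : ℝ) ≤ 2 * d * (3 * N) ^ (d - 1) * (2 ^ m : ℝ) ^ (d - 1) := by
  classical
  let c : ℤ := N * 2 ^ m
  let face : Fin d × Bool → Finset (Fin d → ℤ) := fun p =>
    Fintype.piFinset fun j => if j = p.1 then {if p.2 then c else -c} else Finset.Icc (-c) c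
  have hsub : boundaryGrid d N m ⊆ Finset.univ.biUnion face := by
    intro z hz
    obtain ⟨hz, i, hi⟩ := Finset.mem_filter.1 hz
    rw [Fintype.mem_piFinset] at hz
    have hc : z i = c ∨ z i = -c := by
      rcases abs_choice (z i) with h | h
      · left; rw [← h, hi]
      · right; rw [← neg_neg (z i), ← h, hi]
    rw [Finset.mem_biUnion]
    rcases hc with hc | hc
    · refine ⟨(i, true), Finset.mem_univ _, ?_⟩
      rw [Fintype.mem_piFinset]
      intro j
      by_cases h : j = i
      · subst h; simp [hc]
      · simpa [h] using hz j
    · refine ⟨(i, false), Finset.mem_univ _, ?_⟩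
      rw [Fintype.mem_piFinset]
      intro j
      by_cases h : j = i
      · subst h; simp [hc]
      · simpa [h] using hz j
  have hpow : (1 : ℝ) ≤ N * 2 ^ m := by
    have h1 : (1 : ℝ) ≤ N := by exact_mod_cast hN
    have h2 : (1 : ℝ) ≤ 2 ^ m := one_le_pow₀ one_le_two
    nlinarith
  have hicc : ((Finset.Icc (-c) c).card : ℝ) ≤ 3 * N * 2 ^ m := by
    have hc0 : 0 ≤ c := by positivity
    have h1 : ((Finset.Icc (-c) c).card : ℤ) = 2 * c + 1 := by
      rw [Int.card_Icc]
      omega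
    have h2 : ((Finset.Icc (-c) c).card : ℝ) = 2 * (N * 2 ^ m) + 1 := by
      have := congrArg (Int.cast : ℤ → ℝ) h1
      push_cast [c] at this
      exact this
    rw [h2]
    linarith
  have hface : ∀ p, ((face p).card : ℝ) ≤ (3 * N * 2 ^ m) ^ (d - 1) := by
    intro p
    rw [Fintype.card_piFinset]
    have h1 : ∏ j, (if j = p.1 then ({if p.2 then c else -c} : Finset ℤ)
        else Finset.Icc (-c) c).card = (Finset.Icc (-c) c).card ^ (d - 1) := by
      rw [← Finset.mul_prod_erase _ _ (Finset.mem_univ p.1)]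
      simp only [if_true, Finset.card_singleton, one_mul]
      rw [Finset.prod_congr rfl fun j hj => by rw [if_neg (Finset.ne_of_mem_erase hj)],
        Finset.prod_const, Finset.card_erase_of_mem (Finset.mem_univ _), Finset.card_univ,
        Fintype.card_fin]
    rw [h1]
    push_cast
    gcongr
  calc ((boundaryGrid d N m).card : ℝ) ≤ ((Finset.univ.biUnion face).card : ℝ) := by
        exact_mod_cast Finset.card_le_card hsub
    _ ≤ ∑ p, ((face p).card : ℝ) := by exact_mod_cast Finset.card_biUnion_le
    _ ≤ ∑ _p : Fin d × Bool, (3 * N * 2 ^ m : ℝ) ^ (d - 1) :=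
        Finset.sum_le_sum fun p _ => hface p
    _ = 2 * d * (3 * N) ^ (d - 1) * (2 ^ m : ℝ) ^ (d - 1) := by
        rw [Finset.sum_const, Finset.card_univ, Fintype.card_prod, Fintype.card_fin,
          Fintype.card_bool, nsmul_eq_mul, mul_pow]
        push_cast
        ring

theorem dyadicPoint_mem_cube {N m : ℕ} {z : Fin d → ℤ} (hz : z ∈ boundaryGrid d N m) :
    dyadicPoint m z ∈ cube d N := by
  intro i
  have h1 := Fintype.mem_piFinset.1 (Finset.mem_filter.1 hz).1 i
  have h2 : |z i| ≤ N * 2 ^ m := abs_le.2 (Finset.mem_Icc.1 h1)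
  have h3 : |(z i : ℝ)| ≤ N * 2 ^ m := by exact_mod_cast h2
  simp only [dyadicPoint]
  rw [abs_div, abs_of_pos (by positivity : (0 : ℝ) < 2 ^ m), div_le_iff₀ (by positivity)]
  exact h3

theorem floor_mem_boundaryGrid {N : ℕ} {x : EuclideanSpace ℝ (Fin d)} (hx : x ∈ cube d N)
    {i : Fin d} (hi : |x i| = N) (m : ℕ) :
    (fun j => ⌊2 ^ m * x j⌋) ∈ boundaryGrid d N m := by
  refine Finset.mem_filter.2 ⟨Fintype.mem_piFinset.2 fun j => Finset.mem_Icc.2 ?_, i, ?_⟩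
  · have hp : (0 : ℝ) < 2 ^ m := by positivity
    obtain ⟨h1, h2⟩ := abs_le.1 (hx j)
    constructor
    · rw [Int.le_floor]
      push_cast
      nlinarith
    · have : (⌊2 ^ m * x j⌋ : ℝ) ≤ N * 2 ^ m := (Int.floor_le _).trans (by nlinarith)
      exact_mod_cast this
  · have hc : x i = N ∨ x i = -N := by
      rcases abs_choice (x i) with h | h
      · left; rw [← h, hi]
      · right; rw [← neg_neg (x i), ← h, hi]
    have key : ∀ c : ℤ, x i = c → ⌊2 ^ m * x i⌋ = 2 ^ m * c := by
      intro c hc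
      rw [hc, Int.floor_eq_iff]
      push_cast
      exact ⟨le_rfl, lt_add_one _⟩
    change |⌊2 ^ m * x i⌋| = _
    rcases hc with hc | hc
    · rw [key N (by simpa using hc), mul_comm, abs_of_nonneg (by positivity)]
    · rw [key (-N) (by simpa using hc), mul_neg, abs_neg, mul_comm, abs_of_nonneg (by positivity)]

theorem floor_two_pow_succ_ediv (m : ℕ) (x : ℝ) : ⌊2 ^ (m + 1) * x⌋ / 2 = ⌊2 ^ m * x⌋ := by
  have := Int.floor_div_natCast (2 ^ (m + 1) * x) 2
  push_cast at this
  rw [← this]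
  congr 1
  ring

theorem tendsto_dyadicPoint_floor (x : EuclideanSpace ℝ (Fin d)) :
    Tendsto (fun m : ℕ => dyadicPoint m fun j => ⌊2 ^ m * x j⌋) atTop (nhds x) := by
  have h : Tendsto (fun m : ℕ => fun j => (⌊2 ^ m * x j⌋ : ℝ) / 2 ^ m) atTop (nhds x.ofLp) := by
    rw [tendsto_pi_nhds]
    intro j
    have h1 : Tendsto (fun m : ℕ => (2 : ℝ) ^ m) atTop atTop :=
      tendsto_pow_atTop_atTop_of_one_lt one_lt_two
    have h2 : Tendsto (fun m : ℕ => x j - ((2 : ℝ) ^ m)⁻¹) atTop (nhds (x j)) := by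
      simpa using (tendsto_const_nhds (x := x j)).sub (tendsto_inv_atTop_zero.comp h1)
    refine tendsto_of_tendsto_of_tendsto_of_le_of_le h2 tendsto_const_nhds (fun m => ?_)
      (fun m => ?_)
    · have hp : (0 : ℝ) < 2 ^ m := by positivity
      rw [le_div_iff₀ hp, sub_mul, inv_mul_cancel₀ hp.ne']
      linarith [Int.sub_one_lt_floor ((2 : ℝ) ^ m * x j)]
    · have hp : (0 : ℝ) < 2 ^ m := by positivity
      rw [div_le_iff₀ hp, mul_comm]
      exact Int.floor_le _
  exact ((PiLp.continuous_toLp 2 _).tendsto _).comp h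

theorem dist_dyadicPoint_succ_le (m : ℕ) (z : Fin d → ℤ) :
    dist (dyadicPoint (m + 1) z) (dyadicPoint m fun j => z j / 2) ≤ Real.sqrt d / 2 ^ (m + 1) := by
  rw [EuclideanSpace.dist_eq]
  refine Real.sqrt_le_iff.2 ⟨by positivity, ?_⟩
  rw [div_pow, Real.sq_sqrt (Nat.cast_nonneg d)]
  calc _ ≤ ∑ _i : Fin d, (1 / (2 ^ (m + 1)) ^ 2 : ℝ) := by
        refine Finset.sum_le_sum fun i _ => ?_
        have h1 : (z i : ℝ) = 2 * ((z i / 2 : ℤ) : ℝ) + ((z i % 2 : ℤ) : ℝ) := by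
          exact_mod_cast (Int.mul_ediv_add_emod (z i) 2).symm
        have h2 : (0 : ℝ) ≤ ((z i % 2 : ℤ) : ℝ) := by
          exact_mod_cast Int.emod_nonneg _ two_ne_zero
        have h3 : ((z i % 2 : ℤ) : ℝ) ≤ 1 := by
          have := Int.emod_lt_of_pos (z i) two_pos
          exact_mod_cast (by omega : z i % 2 ≤ 1)
        have h4 : (dyadicPoint (m + 1) z) i - (dyadicPoint m fun j => z j / 2) i
            = ((z i % 2 : ℤ) : ℝ) / 2 ^ (m + 1) := by
          simp only [dyadicPoint]
          rw [h1, pow_succ]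
          field_simp
          ring
        rw [Real.dist_eq, h4, sq_abs, div_pow]
        gcongr
        nlinarith
    _ = d / (2 ^ (m + 1)) ^ 2 := by
        rw [Finset.sum_const, Finset.card_univ, Fintype.card_fin, nsmul_eq_mul, mul_one_div]

/-- Chaining along the dyadic grids on the boundary of a cube. -/
theorem norm_le_of_chain {N m₀ : ℕ} {F : Type*} [NormedAddCommGroup F]
    {g : EuclideanSpace ℝ (Fin d) → F}
    (hg : Continuous g) {A q : ℝ} (hq : q < 1)
    (hbase : ∀ z ∈ boundaryGrid d N m₀, ‖g (dyadicPoint m₀ z)‖ ≤ A)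
    (hstep : ∀ j : ℕ, ∀ z ∈ boundaryGrid d N (m₀ + j + 1),
      dist (g (dyadicPoint (m₀ + j + 1) z)) (g (dyadicPoint (m₀ + j) fun i => z i / 2)) ≤ q ^ j)
    {x : EuclideanSpace ℝ (Fin d)} (hx : x ∈ cube d N) {i : Fin d} (hi : |x i| = N) :
    ‖g x‖ ≤ A + 1 / (1 - q) := by
  let a : ℕ → F := fun j => g (dyadicPoint (m₀ + j) fun i => ⌊2 ^ (m₀ + j) * x i⌋)
  have hlim : Tendsto a atTop (nhds (g x)) := by
    have h1 : Tendsto (fun j : ℕ => m₀ + j) atTop atTop :=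
      tendsto_atTop_mono (fun j => Nat.le_add_left j m₀) tendsto_id
    exact ((hg.tendsto x).comp (tendsto_dyadicPoint_floor x)).comp h1
  have hd : ∀ j, dist (a j) (a (j + 1)) ≤ 1 * q ^ j := by
    intro j
    have := hstep j _ (floor_mem_boundaryGrid hx hi (m₀ + j + 1))
    simp only [floor_two_pow_succ_ediv] at this
    rw [one_mul, dist_comm]
    exact this
  have h1 := dist_le_of_le_geometric_of_tendsto₀ q 1 hq hd hlim
  have h2 := hbase _ (floor_mem_boundaryGrid hx hi m₀)
  have h3 : ‖g x‖ ≤ ‖a 0‖ + dist (a 0) (g x) := by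
    rw [dist_comm, dist_eq_norm]
    exact norm_le_norm_add_norm_sub' _ _
  exact h3.trans (add_le_add h2 h1)

theorem isCompact_cube (d N : ℕ) : IsCompact (cube d N) := by
  refine Metric.isCompact_of_isClosed_isBounded ?_ ?_
  · simp only [cube, ofPred_forall]
    exact isClosed_iInter fun i => isClosed_le (by fun_prop) continuous_const
  · refine (isBounded_iff_forall_norm_le).2 ⟨Real.sqrt (d * N ^ 2), fun x hx => ?_⟩
    rw [EuclideanSpace.norm_eq]
    refine Real.sqrt_le_sqrt ?_
    calc _ ≤ ∑ _i : Fin d, (N : ℝ) ^ 2 := by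
          refine Finset.sum_le_sum fun i _ => ?_
          rw [Real.norm_eq_abs]
          exact pow_le_pow_left₀ (abs_nonneg _) (hx i) 2
      _ = d * N ^ 2 := by simp

theorem exists_abs_eq_of_mem_frontier_cube {N : ℕ} {x : EuclideanSpace ℝ (Fin d)}
    (hx : x ∈ frontier (cube d N)) : x ∈ cube d N ∧ ∃ i, |x i| = N := by
  have hmem : x ∈ cube d N := (isCompact_cube d N).isClosed.frontier_subset hx
  refine ⟨hmem, ?_⟩
  by_contra! hne
  have hopen : IsOpen {y : EuclideanSpace ℝ (Fin d) | ∀ i, |y i| < N} := by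
    simp only [ofPred_forall]
    exact isOpen_iInter_of_finite fun i => isOpen_lt (by fun_prop) continuous_const
  exact hx.2 (interior_maximal (fun y hy i => (hy i).le) hopen
    fun i => lt_of_le_of_ne (hmem i) (hne i))

theorem exists_subset_cube {s : Set (EuclideanSpace ℝ (Fin d))} (hs : Bornology.IsBounded s) :
    ∃ N : ℕ, 1 ≤ N ∧ s ⊆ cube d N := by
  obtain ⟨C, hC⟩ := isBounded_iff_forall_norm_le.1 hs
  refine ⟨⌈C⌉₊ + 1, Nat.le_add_left _ _, fun x hx i => ?_⟩
  calc |x i| ≤ ‖x‖ := PiLp.norm_apply_le x i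
    _ ≤ C := hC x hx
    _ ≤ (⌈C⌉₊ + 1 : ℕ) := by push_cast; linarith [Nat.le_ceil C]

end Grid

section Rates

theorem exp_le_two_pow_ceil {a : ℝ} : Real.exp a ≤ (2 : ℝ) ^ ⌈a / Real.log 2⌉₊ := by
  have hl : 0 < Real.log 2 := Real.log_pos one_lt_two
  rw [← Real.rpow_natCast, Real.rpow_def_of_pos two_pos]
  refine Real.exp_le_exp.2 ?_
  have := Nat.le_ceil (a / Real.log 2)
  rw [div_le_iff₀ hl] at this
  linarith

theorem two_pow_ceil_le_exp {a : ℝ} (ha : 0 ≤ a) :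
    (2 : ℝ) ^ ⌈a / Real.log 2⌉₊ ≤ 2 * Real.exp a := by
  have hl : 0 < Real.log 2 := Real.log_pos one_lt_two
  have := (Nat.ceil_lt_add_one (div_nonneg ha hl.le)).le
  have h2 : Real.log 2 * (⌈a / Real.log 2⌉₊ : ℝ) ≤ Real.log 2 * (a / Real.log 2 + 1) := by gcongr
  rw [mul_add, mul_one, mul_div_cancel₀ _ hl.ne', add_comm] at h2
  rw [← Real.rpow_natCast, Real.rpow_def_of_pos two_pos]
  calc _ ≤ Real.exp (Real.log 2 + a) := Real.exp_le_exp.2 h2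
    _ = 2 * Real.exp a := by rw [Real.exp_add, Real.exp_log two_pos]

theorem exists_rate_of_sqrt_lt {D α c₁ c₂ c₃ γ₀ r₀ k : ℝ} (hD : 1 < D) (hα : 0 < α)
    (hc₂ : 0 < c₂) (hγ₀ : 0 ≤ γ₀) (hr₀ : D ≤ r₀)
    (heq : c₁ * r₀ ^ (1 + α) = γ₀ * (r₀ - (D - 1)))
    (hk : Real.sqrt ((c₃ + γ₀ * (D - 1)) / c₂) < k) :
    ∃ γ > 0, ∃ r > D, c₃ + γ * (D - 1) < c₂ * k ^ 2 ∧ c₁ * r ^ (1 + α) < γ * (r - (D - 1)) := by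
  have hkpos : 0 < k := (Real.sqrt_nonneg _).trans_lt hk
  have h1 : c₃ + γ₀ * (D - 1) < c₂ * k ^ 2 := by
    have := (Real.sqrt_lt' hkpos).1 hk
    rw [div_lt_iff₀ hc₂] at this
    linarith
  set η := (c₂ * k ^ 2 - (c₃ + γ₀ * (D - 1))) / (2 * (D - 1)) with hη
  have hD1 : 0 < D - 1 := by linarith
  have hη0 : 0 < η := div_pos (by linarith) (by linarith)
  have hη1 : η * (D - 1) = (c₂ * k ^ 2 - (c₃ + γ₀ * (D - 1))) / 2 := by
    rw [hη]; field_simp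
  have hcont : Continuous fun r : ℝ => (γ₀ + η) * (r - (D - 1)) - c₁ * r ^ (1 + α) := by
    have := Real.continuous_rpow_const (q := 1 + α) (by linarith)
    fun_prop
  have hpos : 0 < (γ₀ + η) * (r₀ - (D - 1)) - c₁ * r₀ ^ (1 + α) := by
    rw [heq]
    nlinarith
  have hev : ∀ᶠ r in nhdsWithin r₀ (Ioi r₀),
      0 < (γ₀ + η) * (r - (D - 1)) - c₁ * r ^ (1 + α) :=
    ((hcont.tendsto r₀).mono_left nhdsWithin_le_nhds).eventually (lt_mem_nhds hpos)
  obtain ⟨r, hr, hrr⟩ := (hev.and self_mem_nhdsWithin).exists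
  exact ⟨γ₀ + η, by linarith, r, hr₀.trans_lt hrr, by linarith, by linarith⟩

end Rates

section GridEvents

variable {Ω : Type*} [MeasurableSpace Ω] {μ : Measure Ω} {d N : ℕ}

theorem measure_biUnion_finset_le_ofReal {ι : Type*} (S : Finset ι) {A : ι → Set Ω} {b : ℝ}
    (h : ∀ z ∈ S, μ (A z) ≤ ENNReal.ofReal b) :
    μ (⋃ z ∈ S, A z) ≤ ENNReal.ofReal (S.card * b) := by
  refine (measure_biUnion_finset_le S A).trans ((Finset.sum_le_card_nsmul S _ _ h).trans ?_)
  rw [nsmul_eq_mul, ENNReal.ofReal_mul (Nat.cast_nonneg _), ENNReal.ofReal_natCast]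

theorem ae_eventually_forall_boundaryGrid_lt (hd : 1 ≤ d) (hN : 1 ≤ N)
    {Z : ℕ → EuclideanSpace ℝ (Fin d) → Ω → ℝ} {a : ℕ → ℝ} {b γ : ℝ} (hγ : 0 ≤ γ)
    (hb : b + γ * (d - 1) < 0)
    (h : ∀ᶠ n : ℕ in atTop, ∀ x ∈ cube d N,
      μ {ω | a n ≤ Z n x ω} ≤ ENNReal.ofReal (Real.exp (b * n))) :
    ∀ᵐ ω ∂μ, ∀ᶠ n : ℕ in atTop, ∀ z ∈ boundaryGrid d N ⌈γ * n / Real.log 2⌉₊,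
      Z n (dyadicPoint ⌈γ * n / Real.log 2⌉₊ z) ω < a n := by
  have hmain := ae_eventually_notMem_of_le_exp (μ := μ)
    (s := fun n => ⋃ z ∈ boundaryGrid d N ⌈γ * n / Real.log 2⌉₊,
      {ω | a n ≤ Z n (dyadicPoint ⌈γ * n / Real.log 2⌉₊ z) ω})
    (C := 2 * d * (3 * N) ^ (d - 1) * 2 ^ (d - 1)) (δ := -(b + γ * (d - 1))) (by linarith) (by
      filter_upwards [h] with n hn
      refine (measure_biUnion_finset_le_ofReal _
        fun z hz => hn _ (dyadicPoint_mem_cube hz)).trans (ENNReal.ofReal_le_ofReal ?_)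
      have h1 := two_pow_ceil_le_exp (a := γ * n) (by positivity)
      have hd' : ((d - 1 : ℕ) : ℝ) = d - 1 := by rw [Nat.cast_sub hd, Nat.cast_one]
      calc _ ≤ (2 * d * (3 * N) ^ (d - 1) * (2 * Real.exp (γ * n)) ^ (d - 1))
              * Real.exp (b * n) := by
            refine mul_le_mul_of_nonneg_right ((card_boundaryGrid_le hN _).trans ?_)
              (Real.exp_pos _).le
            gcongr
        _ = _ := by
            rw [mul_pow (2 : ℝ) (Real.exp (γ * n)), ← Real.exp_nat_mul, hd']
            have : Real.exp (- -(b + γ * (d - 1)) * n)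
                = Real.exp ((d - 1) * (γ * n)) * Real.exp (b * n) := by
              rw [← Real.exp_add]
              ring_nf
            rw [this]
            ring)
  filter_upwards [hmain] with ω hω
  filter_upwards [hω] with n hn z hz
  by_contra hcon
  exact hn (mem_biUnion hz (not_lt.1 hcon))

theorem chaining_weight_le {r s P L c D q : ℝ} (hs : 1 < s) (hrs : s = r - ((d : ℝ) - 1))
    (hd : 1 ≤ d) (hr : 0 < r) (hP : 0 < P) (hL : 0 < L) (hc : 0 ≤ c) (hD : 0 ≤ D)
    (hq : q = 2 ^ (-(s - 1) / r)) (j : ℕ) :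
    (P * 2 ^ (j + 1)) ^ (d - 1) * (c * (D / (P * 2 ^ (j + 1))) * L / q ^ j) ^ r
      ≤ (c * D) ^ r * (P ^ (-s) * L ^ r) * (1 / 2) ^ j := by
  have hq0 : 0 < q := hq ▸ Real.rpow_pos_of_pos two_pos _
  have hX : 0 < P * 2 ^ (j + 1) := by positivity
  have hd' : ((d - 1 : ℕ) : ℝ) = d - 1 := by rw [Nat.cast_sub hd, Nat.cast_one]
  have h1 : (c * (D / (P * 2 ^ (j + 1))) * L / q ^ j) ^ r
      = (c * D) ^ r * L ^ r * ((P * 2 ^ (j + 1)) ^ (-r) * (q ^ j) ^ (-r)) := by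
    have : c * (D / (P * 2 ^ (j + 1))) * L / q ^ j
        = (c * D) * L * ((P * 2 ^ (j + 1))⁻¹ * (q ^ j)⁻¹) := by
      field_simp
    rw [this, Real.mul_rpow (x := c * D * L) (by positivity) (by positivity),
      Real.mul_rpow (x := c * D) (y := L) (by positivity) hL.le,
      Real.mul_rpow (x := (P * 2 ^ (j + 1))⁻¹) (by positivity) (by positivity),
      Real.inv_rpow hX.le, Real.inv_rpow (by positivity), Real.rpow_neg hX.le,
      Real.rpow_neg (by positivity)]
  have h2 : (P * 2 ^ (j + 1)) ^ (d - 1) * (P * 2 ^ (j + 1)) ^ (-r)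
      = P ^ (-s) * 2 ^ (-((j : ℝ) + 1) * s) := by
    rw [← Real.rpow_natCast (P * 2 ^ (j + 1)), ← Real.rpow_add hX, hd',
      show (d : ℝ) - 1 + -r = -s by rw [hrs]; ring, Real.mul_rpow hP.le (by positivity),
      ← Real.rpow_natCast 2 (j + 1), ← Real.rpow_mul two_pos.le]
    push_cast
    ring_nf
  have h3 : (q ^ j) ^ (-r) = 2 ^ ((s - 1) * j) := by
    rw [hq, ← Real.rpow_natCast, ← Real.rpow_mul two_pos.le, ← Real.rpow_mul two_pos.le]
    congr 1
    field_simp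
  have h4 : (2 : ℝ) ^ (-((j : ℝ) + 1) * s) * 2 ^ ((s - 1) * j) ≤ (1 / 2) ^ j := by
    rw [← Real.rpow_add two_pos, one_div, inv_pow, ← Real.rpow_natCast, ← Real.rpow_neg two_pos.le]
    refine Real.rpow_le_rpow_of_exponent_le one_le_two ?_
    linarith
  calc _ = (c * D) ^ r * L ^ r * (((P * 2 ^ (j + 1)) ^ (d - 1) * (P * 2 ^ (j + 1)) ^ (-r))
          * (q ^ j) ^ (-r)) := by rw [h1]; ring
    _ = (c * D) ^ r * (P ^ (-s) * L ^ r)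
          * (2 ^ (-((j : ℝ) + 1) * s) * 2 ^ ((s - 1) * j)) := by rw [h2, h3]; ring
    _ ≤ _ := by gcongr

theorem ae_eventually_forall_boundaryGrid_step_lt (hd : 1 ≤ d) (hN : 1 ≤ N)
    {W : ℕ → EuclideanSpace ℝ (Fin d) → EuclideanSpace ℝ (Fin d) → Ω → ℝ}
    {c l r γ q : ℝ} (hc : 0 ≤ c) (hr : d < r) (hl : l * r < γ * (r - (d - 1)))
    (hq : q = 2 ^ (-(r - d) / r))
    (h : ∀ n : ℕ, 1 ≤ n → ∀ x y, ∀ a > 0, μ {ω | a ≤ W n x y ω} ≤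
      ENNReal.ofReal ((c * dist x y * Real.exp (l * n) / a) ^ r)) :
    ∀ᵐ ω ∂μ, ∀ᶠ n : ℕ in atTop, ∀ j : ℕ,
      ∀ z ∈ boundaryGrid d N (⌈γ * n / Real.log 2⌉₊ + j + 1),
        W n (dyadicPoint (⌈γ * n / Real.log 2⌉₊ + j + 1) z)
          (dyadicPoint (⌈γ * n / Real.log 2⌉₊ + j) fun i => z i / 2) ω < q ^ j := by
  set s := r - ((d : ℝ) - 1) with hs
  have hs1 : 1 < s := by linarith
  have hr0 : 0 < r := (Nat.cast_nonneg d).trans_lt hr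
  have hq0 : 0 < q := hq ▸ Real.rpow_pos_of_pos two_pos _
  set K : ℝ := 2 * d * (3 * N) ^ (d - 1) * (c * Real.sqrt d) ^ r with hK
  have hK0 : 0 ≤ K := by positivity
  have hmain := ae_eventually_notMem_of_le_exp (μ := μ)
    (s := fun n : ℕ => ⋃ j : ℕ, ⋃ z ∈ boundaryGrid d N (⌈γ * n / Real.log 2⌉₊ + j + 1),
      {ω | q ^ j ≤ W n (dyadicPoint (⌈γ * n / Real.log 2⌉₊ + j + 1) z)
        (dyadicPoint (⌈γ * n / Real.log 2⌉₊ + j) fun i => z i / 2) ω})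
    (C := K * 2) (δ := γ * s - l * r) (by linarith) (by
      filter_upwards [eventually_ge_atTop 1] with n hn
      set m := ⌈γ * n / Real.log 2⌉₊ with hm
      have hterm : ∀ j : ℕ, μ (⋃ z ∈ boundaryGrid d N (m + j + 1),
          {ω | q ^ j ≤ W n (dyadicPoint (m + j + 1) z)
            (dyadicPoint (m + j) fun i => z i / 2) ω})
          ≤ ENNReal.ofReal (K * Real.exp (-(γ * s - l * r) * n) * (1 / 2) ^ j) := by
        intro j
        have hpow : (2 : ℝ) ^ (m + j + 1) = 2 ^ m * 2 ^ (j + 1) := by rw [add_assoc, pow_add]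
        refine (measure_biUnion_finset_le_ofReal _ (b := (c * (Real.sqrt d / (2 ^ m * 2 ^ (j + 1)))
          * Real.exp (l * n) / q ^ j) ^ r) fun z hz => (h n hn _ _ _ (by positivity)).trans
            (ENNReal.ofReal_le_ofReal ?_)).trans (ENNReal.ofReal_le_ofReal ?_)
        · have := dist_dyadicPoint_succ_le (m + j) z
          rw [hpow] at this
          gcongr
        · have hw := chaining_weight_le (d := d) (L := Real.exp (l * n)) (c := c)
            (D := Real.sqrt d) (P := 2 ^ m) (q := q) hs1 hs hd hr0
            (by positivity) (Real.exp_pos _) hc (Real.sqrt_nonneg _) (by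
              rw [hq, hs]; congr 2; ring) j
          have hP : ((2 : ℝ) ^ m) ^ (-s) ≤ Real.exp (-(γ * n * s)) := by
            have h1 := Real.rpow_le_rpow_of_nonpos (Real.exp_pos (γ * n))
              (exp_le_two_pow_ceil (a := γ * n)) (by linarith : -s ≤ 0)
            rwa [← Real.exp_mul, mul_neg] at h1
          have hPL : ((2 : ℝ) ^ m) ^ (-s) * Real.exp (l * n) ^ r
              ≤ Real.exp (-(γ * s - l * r) * n) := by
            rw [← Real.exp_mul]
            refine (mul_le_mul_of_nonneg_right hP (Real.exp_pos _).le).trans (le_of_eq ?_)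
            rw [← Real.exp_add]
            ring_nf
          have hcard := card_boundaryGrid_le (d := d) hN (m + j + 1)
          rw [hpow] at hcard
          calc _ ≤ (2 * d * (3 * N) ^ (d - 1) * (2 ^ m * 2 ^ (j + 1)) ^ (d - 1)) *
                (c * (Real.sqrt d / (2 ^ m * 2 ^ (j + 1))) * Real.exp (l * n) / q ^ j) ^ r :=
                mul_le_mul_of_nonneg_right hcard (by positivity)
            _ = 2 * d * (3 * N) ^ (d - 1) * ((2 ^ m * 2 ^ (j + 1)) ^ (d - 1) *
                (c * (Real.sqrt d / (2 ^ m * 2 ^ (j + 1))) * Real.exp (l * n) / q ^ j) ^ r) := by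
                ring
            _ ≤ 2 * d * (3 * N) ^ (d - 1) * ((c * Real.sqrt d) ^ r *
                (Real.exp (-(γ * s - l * r) * n)) * (1 / 2) ^ j) := by
                refine mul_le_mul_of_nonneg_left (hw.trans ?_) (by positivity)
                gcongr
            _ = _ := by rw [hK]; ring
      have hsum := hasSum_geometric_two.mul_left
        (K * Real.exp (-(γ * s - l * r) * n))
      refine (measure_iUnion_le _).trans ((ENNReal.tsum_le_tsum hterm).trans ?_)
      rw [← ENNReal.ofReal_tsum_of_nonneg (fun j => by positivity) hsum.summable, hsum.tsum_eq]
      exact ENNReal.ofReal_le_ofReal (le_of_eq (by ring)))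
  filter_upwards [hmain] with ω hω
  filter_upwards [hω] with n hn j z hz
  by_contra hcon
  exact hn (mem_iUnion.2 ⟨j, mem_biUnion hz (not_lt.1 hcon)⟩)

end GridEvents

section Flow

variable {Ω : Type*} [MeasurableSpace Ω] {μ : Measure Ω}

theorem integrable_biSup_dist_rpow [IsProbabilityMeasure μ] {E : Type*} [NormedAddCommGroup E]
    [MeasurableSpace E] [BorelSpace E] [SecondCountableTopology E] {f g : ℝ → Ω → E}
    (hf : ∀ t, Measurable (f t)) (hg : ∀ t, Measurable (g t))
    (hfc : ∀ ω, Continuous fun t => f t ω) (hgc : ∀ ω, Continuous fun t => g t ω)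
    {k T₀ : ℝ} (hk : 0 < k)
    (hft : ∀ T ≥ T₀, μ {ω | k * T ≤ ⨆ t ∈ Icc (0 : ℝ) T, ‖f t ω‖}
      ≤ ENNReal.ofReal (Real.exp (-2 * T)))
    (hgt : ∀ T ≥ T₀, μ {ω | k * T ≤ ⨆ t ∈ Icc (0 : ℝ) T, ‖g t ω‖}
      ≤ ENNReal.ofReal (Real.exp (-2 * T)))
    {T r : ℝ} (hT : 0 ≤ T) (hr : 0 < r) :
    Integrable (fun ω => (⨆ t ∈ Icc (0 : ℝ) T, dist (f t ω) (g t ω)) ^ r) μ := by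
  refine integrable_rpow_of_exp_tail (k := 2 * k) (T₀ := max (max T₀ T) 1)
    (measurable_biSup_Icc (fun t => (hf t).dist (hg t)) (fun ω => (hfc ω).dist (hgc ω))
      (fun t ω => dist_nonneg) hT)
    (fun ω => biSup_Icc_nonneg (fun t => dist_nonneg) T) (by positivity) (by positivity)
    (fun S hS => ?_) hr
  have hST₀ : T₀ ≤ S := (le_max_left _ _).trans ((le_max_left _ _).trans hS)
  have hST : T ≤ S := (le_max_right _ _).trans ((le_max_left _ _).trans hS)
  have hS1 : 1 ≤ S := (le_max_right _ _).trans hS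
  have hsub : {ω | 2 * k * S ≤ ⨆ t ∈ Icc (0 : ℝ) T, dist (f t ω) (g t ω)}
      ⊆ {ω | k * S ≤ ⨆ t ∈ Icc (0 : ℝ) S, ‖f t ω‖}
        ∪ {ω | k * S ≤ ⨆ t ∈ Icc (0 : ℝ) S, ‖g t ω‖} := by
    intro ω hω
    have hle : (⨆ t ∈ Icc (0 : ℝ) T, dist (f t ω) (g t ω))
        ≤ (⨆ t ∈ Icc (0 : ℝ) S, ‖f t ω‖) + ⨆ t ∈ Icc (0 : ℝ) S, ‖g t ω‖ := by
      refine biSup_le_of_forall_le (fun t ht => ?_)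
        (add_nonneg (biSup_Icc_nonneg (fun _ => norm_nonneg _) S)
          (biSup_Icc_nonneg (fun _ => norm_nonneg _) S))
      have htS : t ∈ Icc 0 S := ⟨ht.1, ht.2.trans hST⟩
      rw [dist_eq_norm]
      exact (norm_sub_le _ _).trans
        (add_le_add ((hfc ω).norm.le_biSup_Icc htS) ((hgc ω).norm.le_biSup_Icc htS))
    by_contra hcon
    simp only [mem_union, mem_ofPred_eq, not_or, not_le] at hcon hω
    linarith [hcon.1, hcon.2]
  refine (measure_mono hsub).trans ((measure_union_le _ _).trans
    ((add_le_add (hft S hST₀) (hgt S hST₀)).trans ?_))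
  rw [← ENNReal.ofReal_add (Real.exp_pos _).le (Real.exp_pos _).le]
  refine ENNReal.ofReal_le_ofReal ?_
  have h2 : 2 ≤ Real.exp S := by linarith [Real.add_one_le_exp S]
  have h3 : Real.exp (-2 * S) * Real.exp S = Real.exp (-S) := by
    rw [← Real.exp_add]
    ring_nf
  nlinarith [Real.exp_pos (-2 * S)]

theorem eventually_measure_le_of_limsup_biSup {E : Type*} [PseudoMetricSpace E]
    {p : ℝ → E → Set Ω} {S : Set E} {a b : ℝ}
    (h : limsup (fun T : ℝ => ((1 / T : ℝ) : EReal) * ENNReal.log (⨆ x ∈ S, μ (p T x))) atTop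
      ≤ (a : EReal)) (hab : a < b) :
    ∀ᶠ T in atTop, ∀ x ∈ S, μ (p T x) ≤ ENNReal.ofReal (Real.exp (b * T)) := by
  filter_upwards [eventually_le_exp_of_limsup_log_lt h hab] with T hT x hx
  exact (le_iSup₂ (f := fun x (_ : x ∈ S) => μ (p T x)) x hx).trans hT

variable {d : ℕ}

theorem ae_eventually_forall_cube_norm_le [IsProbabilityMeasure μ] (hd : 2 ≤ d)
    {α c₁ c₂ c₃ : ℝ} (hc₂ : 0 < c₂)
    {ψ : ℝ → EuclideanSpace ℝ (Fin d) → Ω → EuclideanSpace ℝ (Fin d)}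
    (hmeas : ∀ t x, Measurable (ψ t x))
    (hcont : ∀ ω : Ω, Continuous fun p : ℝ × EuclideanSpace ℝ (Fin d) => ψ p.1 p.2 ω)
    (hinj : ∀ ω : Ω, ∀ t : ℝ, 0 ≤ t → Function.Injective fun x => ψ t x ω)
    (hH : ∀ r : ℝ, (d : ℝ) < r → ∃ c > 0, ∀ x y : EuclideanSpace ℝ (Fin d), ∀ T > 0,
      (∫ ω, (⨆ t ∈ Icc (0 : ℝ) T, dist (ψ t x ω) (ψ t y ω)) ^ r ∂μ) ^ (1 / r)
        ≤ c * dist x y * Real.exp (c₁ * r ^ α * T))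
    (honept : ∀ k : ℝ, 0 < k → ∀ S : Set (EuclideanSpace ℝ (Fin d)), Bornology.IsBounded S →
      limsup (fun T : ℝ => ((1 / T : ℝ) : EReal) *
          ENNReal.log (⨆ x ∈ S, μ {ω | k * T ≤ ⨆ t ∈ Icc (0 : ℝ) T, ‖ψ t x ω‖}))
        atTop ≤ ((-c₂ * k ^ 2 + c₃ : ℝ) : EReal))
    {N : ℕ} (hN : 1 ≤ N) {k γ r : ℝ} (hk : 0 < k) (hγ : 0 < γ) (hr : d < r)
    (hkγ : c₃ + γ * (d - 1) < c₂ * k ^ 2) (hrγ : c₁ * r ^ (1 + α) < γ * (r - (d - 1))) :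
    ∃ C ≥ 0, ∀ᵐ ω ∂μ, ∀ᶠ n : ℕ in atTop, ∀ t ∈ Icc (0 : ℝ) n, ∀ x ∈ cube d N,
      ‖ψ t x ω‖ ≤ k * n + C := by
  have hr0 : 0 < r := (Nat.cast_nonneg d).trans_lt hr
  have hd1 : 1 ≤ d := by omega
  have : Nontrivial (EuclideanSpace ℝ (Fin d)) := by
    have : Nonempty (Fin d) := ⟨⟨0, by omega⟩⟩
    infer_instance
  have hct : ∀ x ω, Continuous fun t => ψ t x ω := fun x ω =>
    (hcont ω).comp (continuous_id.prodMk continuous_const)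
  have hcx : ∀ t ω, Continuous fun x => ψ t x ω := fun t ω =>
    (hcont ω).comp (continuous_const.prodMk continuous_id)
  obtain ⟨k', hk', hk2⟩ : ∃ k' > 0, -c₂ * k' ^ 2 + c₃ < -2 := by
    have hlim : Tendsto (fun k' : ℝ => c₂ * k' ^ 2) atTop atTop :=
      (tendsto_pow_atTop two_ne_zero).const_mul_atTop hc₂
    obtain ⟨k', h1, h2⟩ := ((eventually_gt_atTop 0).and
      (hlim.eventually_gt_atTop (c₃ + 2))).exists
    exact ⟨k', h1, by linarith⟩
  have hint : ∀ x y, ∀ T ≥ 0,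
      Integrable (fun ω => (⨆ t ∈ Icc (0 : ℝ) T, dist (ψ t x ω) (ψ t y ω)) ^ r) μ := by
    intro x y T hT
    obtain ⟨T₀, hT₀⟩ := eventually_atTop.1 (eventually_measure_le_of_limsup_biSup
      (honept k' hk' {x, y} (toFinite _).isBounded) hk2)
    exact integrable_biSup_dist_rpow (fun t => hmeas t x) (fun t => hmeas t y) (hct x) (hct y) hk'
      (fun S hS => hT₀ S hS x (by simp)) (fun S hS => hT₀ S hS y (by simp)) hT hr0
  obtain ⟨c, hc, hcH⟩ := hH r hr
  set q : ℝ := 2 ^ (-(r - d) / r) with hq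
  have hq1 : q < 1 := Real.rpow_lt_one_of_one_lt_of_neg one_lt_two
    (div_neg_of_neg_of_pos (by linarith) hr0)
  refine ⟨1 / (1 - q), by have := sub_pos.2 hq1; positivity, ?_⟩
  have hl : c₁ * r ^ α * r < γ * (r - (d - 1)) := by
    rwa [mul_assoc, ← Real.rpow_add_one hr0.ne', add_comm α]
  have hstep := ae_eventually_forall_boundaryGrid_step_lt (μ := μ) (N := N)
    (W := fun n x y ω => ⨆ t ∈ Icc (0 : ℝ) n, dist (ψ t x ω) (ψ t y ω)) hd1 hN hc.le hr hl hq
    (fun n hn x y a ha => measure_ge_le_of_integral_rpow_le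
      (fun ω => biSup_Icc_nonneg (fun _ => dist_nonneg) n) hr0 (hint x y n (Nat.cast_nonneg n))
      (hcH x y n (by exact_mod_cast hn)) ha)
  obtain ⟨b, hb, hb'⟩ := exists_between (show -c₂ * k ^ 2 + c₃ < -(γ * (d - 1)) by linarith)
  have hbase := ae_eventually_forall_boundaryGrid_lt (μ := μ) (N := N)
    (Z := fun n x ω => ⨆ t ∈ Icc (0 : ℝ) n, ‖ψ t x ω‖) (a := fun n => k * n) hd1 hN hγ.le
    (show b + γ * (d - 1) < 0 by linarith)
    (tendsto_natCast_atTop_atTop.eventually (eventually_measure_le_of_limsup_biSup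
      (honept k hk (cube d N) (isCompact_cube d N).isBounded) hb))
  filter_upwards [hstep, hbase] with ω hω₁ hω₂
  filter_upwards [hω₁, hω₂] with n hn₁ hn₂ t ht x hx
  obtain ⟨y, hy, hxy⟩ := exists_frontier_norm_le_of_injective (hcx t ω) (hinj ω t ht.1)
    (isCompact_cube d N) hx
  obtain ⟨hyc, i, hi⟩ := exists_abs_eq_of_mem_frontier_cube hy
  refine hxy.trans (norm_le_of_chain (m₀ := ⌈γ * n / Real.log 2⌉₊) (hcx t ω) hq1 (fun z hz => ?_)
    (fun j z hz => ?_) hyc hi)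
  · exact ((hct _ ω).norm.le_biSup_Icc ht).trans (hn₂ z hz).le
  · exact (((hct _ ω).dist (hct _ ω)).le_biSup_Icc ht).trans (hn₁ j z hz).le

theorem mul_rpow_eq_of_eq_div {α D c₁ : ℝ} (hα : 0 < α) (hD : 1 < D) :
    c₁ * ((1 + α) * ((D - 1) / α)) ^ (1 + α)
      = c₁ * ((D - 1) / α) ^ α * (1 + α) ^ (1 + α) * ((1 + α) * ((D - 1) / α) - (D - 1)) := by
  have hx : 0 < (D - 1) / α := div_pos (by linarith) hα
  have h : (1 + α) * ((D - 1) / α) - (D - 1) = (D - 1) / α := by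
    field_simp
    ring
  rw [h, Real.mul_rpow (by linarith) hx.le, add_comm 1 α, Real.rpow_add_one hx.ne']
  ring

end Flow

theorem statement3
    {Ω : Type} [MeasurableSpace Ω] (ℙ : Measure Ω) [IsProbabilityMeasure ℙ]
    (d : ℕ) (hd : 2 ≤ d) (α c₁ c₂ c₃ : ℝ)
    (hα : 0 < α) (hc₁ : 0 < c₁) (hc₂ : 0 < c₂) (hc₃ : 0 ≤ c₃)
    (ψ : ℝ → EuclideanSpace ℝ (Fin d) → Ω → EuclideanSpace ℝ (Fin d))
    (hmeas : Measurable fun p : ℝ × EuclideanSpace ℝ (Fin d) × Ω => ψ p.1 p.2.1 p.2.2)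
    (hcont : ∀ ω : Ω, Continuous fun p : ℝ × EuclideanSpace ℝ (Fin d) => ψ p.1 p.2 ω)
    (hinj : ∀ ω : Ω, ∀ t : ℝ, 0 ≤ t → Function.Injective fun x => ψ t x ω)
    (hH : ∀ r : ℝ, (d : ℝ) < r → ∃ c > 0, ∀ x y : EuclideanSpace ℝ (Fin d), ∀ T > 0,
      (∫ ω, (⨆ t ∈ Icc (0 : ℝ) T, dist (ψ t x ω) (ψ t y ω)) ^ r ∂ℙ) ^ (1 / r)
        ≤ c * dist x y * Real.exp (c₁ * r ^ α * T))
    (honept : ∀ k : ℝ, 0 < k → ∀ S : Set (EuclideanSpace ℝ (Fin d)), Bornology.IsBounded S →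
      Filter.limsup (fun T : ℝ => ((1 / T : ℝ) : EReal) *
          ENNReal.log (⨆ x ∈ S, ℙ {ω | k * T ≤ ⨆ t ∈ Icc (0 : ℝ) T, ‖ψ t x ω‖}))
        Filter.atTop ≤ ((-c₂ * k ^ 2 + c₃ : ℝ) : EReal))
    (𝒳 : Set (EuclideanSpace ℝ (Fin d))) (hX : IsCompact 𝒳) :
    ∀ᵐ ω ∂ℙ, Filter.limsup (fun T : ℝ =>
        (((1 / T) * ⨆ t ∈ Icc (0 : ℝ) T, ⨆ x ∈ 𝒳, ‖ψ t x ω‖ : ℝ) : EReal)) Filter.atTop ≤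
      ((if (d : ℝ) < α + 1
        then Real.sqrt ((c₃ + (c₁ * (d : ℝ) ^ (α + 1)) * ((d : ℝ) - 1)) / c₂)
        else Real.sqrt ((c₃ + (c₁ * (((d : ℝ) - 1) / α) ^ α * (1 + α) ^ (1 + α)) * ((d : ℝ) - 1)) / c₂)
        : ℝ) : EReal) := by
  have hD : (1 : ℝ) < d := by exact_mod_cast hd
  have hD1 : (0 : ℝ) < d - 1 := by linarith
  obtain ⟨γ₀, r₀, hγ₀, hr₀, heq, hκ⟩ : ∃ γ₀ r₀ : ℝ, 0 ≤ γ₀ ∧ (d : ℝ) ≤ r₀ ∧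
      c₁ * r₀ ^ (1 + α) = γ₀ * (r₀ - (d - 1)) ∧
      (if (d : ℝ) < α + 1
        then Real.sqrt ((c₃ + (c₁ * (d : ℝ) ^ (α + 1)) * ((d : ℝ) - 1)) / c₂)
        else Real.sqrt ((c₃ + (c₁ * (((d : ℝ) - 1) / α) ^ α * (1 + α) ^ (1 + α)) * ((d : ℝ) - 1))
          / c₂)) = Real.sqrt ((c₃ + γ₀ * ((d : ℝ) - 1)) / c₂) := by
    split_ifs with h
    · exact ⟨_, d, by positivity, le_rfl, by rw [add_comm]; ring, rfl⟩
    · refine ⟨_, (1 + α) * (((d : ℝ) - 1) / α), by positivity, ?_, mul_rpow_eq_of_eq_div hα hD, rfl⟩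
      rw [mul_div_assoc', le_div_iff₀ hα]
      nlinarith
  rw [hκ]
  set κ := Real.sqrt ((c₃ + γ₀ * ((d : ℝ) - 1)) / c₂) with hκdef
  obtain ⟨N, hN, hXN⟩ := exists_subset_cube hX.isBounded
  have key : ∀ m : ℕ, ∀ᵐ ω ∂ℙ, limsup (fun T : ℝ =>
      (((1 / T) * ⨆ t ∈ Icc (0 : ℝ) T, ⨆ x ∈ 𝒳, ‖ψ t x ω‖ : ℝ) : EReal)) atTop
        ≤ ((κ + 1 / ((m : ℝ) + 1) : ℝ) : EReal) := by
    intro m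
    have hlt : κ < κ + 1 / ((m : ℝ) + 1) := lt_add_of_pos_right _ Nat.one_div_pos_of_nat
    have hk : 0 < κ + 1 / ((m : ℝ) + 1) := (Real.sqrt_nonneg _).trans_lt hlt
    obtain ⟨γ, hγ, r, hr, hkγ, hrγ⟩ := exists_rate_of_sqrt_lt hD hα hc₂ hγ₀ hr₀ heq hlt
    obtain ⟨C, hC, hae⟩ := ae_eventually_forall_cube_norm_le (ψ := ψ) hd hc₂
      (fun t x => hmeas.comp (measurable_const.prodMk (measurable_const.prodMk measurable_id)))
      hcont hinj hH honept hN hk hγ hr hkγ hrγ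
    filter_upwards [hae] with ω hω
    exact limsup_biSup_div_le (f := fun t x => ψ t x ω) hk.le hC
      (hω.mono fun n hn t ht x hx => hn t ht x (hXN hx))
  filter_upwards [ae_all_iff.2 key] with ω hω
  have hlim : Tendsto (fun m : ℕ => ((κ + 1 / ((m : ℝ) + 1) : ℝ) : EReal)) atTop
      (nhds (κ : EReal)) := by
    refine (continuous_coe_real_ereal.tendsto κ).comp ?_
    simpa using (tendsto_const_nhds (x := κ)).add tendsto_one_div_add_atTop_nhds_zero_nat
  exact ge_of_tendsto' hlim hω
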